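/- Let x ∈ S̃_{k+1}. Suppose A = [i, j₁] and B = [p, j₂] are cyclic intervals, each a proper subset of I, such that ℓ(x d_A^{−1}) = ℓ(x) − |A| and A is maximal under inclusion among cyclic intervals with left endpoint i having this property, and likewise ℓ(x d_B^{−1}) = ℓ(x) − |B| with B maximal among cyclic intervals with left endpoint p having this property. Then: if A ∩ B ≠ ∅, then A ⊆ B or B ⊆ A; and if A ∩ B = ∅, then A ∪ B is not a cyclic interval. -/

import Mathlib

/-- `x : Equiv.Perm ℤ` is an affine permutation in `S̃_{k+1}`: it commutes with
translation by `k+1` and its window sums to `(k+1)(k+2)/2`. -/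
def IsAffinePerm (k : ℕ) (x : Equiv.Perm ℤ) : Prop :=
  (∀ i : ℤ, x (i + (k + 1)) = x i + (k + 1)) ∧
  ∑ i ∈ Finset.Icc (1 : ℤ) (k + 1), x i = (k + 1) * (k + 2) / 2

/-- The underlying function of the simple generator `s_i`. -/
def sAffFun (k : ℕ) (i : ZMod (k + 1)) (j : ℤ) : ℤ :=
  if (j : ZMod (k + 1)) = i then j + 1
  else if (j : ZMod (k + 1)) = i + 1 then j - 1
  else j

theorem sAffFun_invol (k : ℕ) (i : ZMod (k + 1)) (h : ¬ (1 : ZMod (k + 1)) = 0) :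
    Function.Involutive (sAffFun k i) := by
  have hne : i + 1 ≠ i := fun hc => h (by
    have h2 : i + 1 = i + 0 := by simpa using hc
    exact add_left_cancel h2)
  intro j
  by_cases h1 : (j : ZMod (k + 1)) = i
  · have e1 : sAffFun k i j = j + 1 := if_pos h1
    have hj1 : ((j + 1 : ℤ) : ZMod (k + 1)) = i + 1 := by push_cast; rw [h1]
    have e2 : sAffFun k i (j + 1) = j := by
      unfold sAffFun
      rw [if_neg (by rw [hj1]; exact hne), if_pos hj1]
      ring
    rw [e1, e2]
  · by_cases h2 : (j : ZMod (k + 1)) = i + 1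
    · have e1 : sAffFun k i j = j - 1 := by unfold sAffFun; rw [if_neg h1, if_pos h2]
      have hj1 : ((j - 1 : ℤ) : ZMod (k + 1)) = i := by push_cast; rw [h2]; ring
      have e2 : sAffFun k i (j - 1) = j := by
        unfold sAffFun; rw [if_pos hj1]; ring
      rw [e1, e2]
    · have e1 : sAffFun k i j = j := by unfold sAffFun; rw [if_neg h1, if_neg h2]
      rw [e1, e1]

/-- The simple generator `s_i` of the affine symmetric group, as a permutation of `ℤ`:
it interchanges `m(k+1) + ī` and `m(k+1) + ī + 1` for every `m` (when `k ≥ 1`). -/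
noncomputable def sAff (k : ℕ) (i : ZMod (k + 1)) : Equiv.Perm ℤ :=
  if h : (1 : ZMod (k + 1)) = 0 then 1 else Function.Involutive.toPerm _ (sAffFun_invol k i h)

/-- The Coxeter length of `x`: the least number of simple generators whose product is `x`. -/
noncomputable def affLen (k : ℕ) (x : Equiv.Perm ℤ) : ℕ :=
  sInf {n : ℕ | ∃ w : List (ZMod (k + 1)), w.length = n ∧ x = (w.map (sAff k)).prod}

/-- The right descent set `D_R(x) = {i : ℓ(x s_i) < ℓ(x)}`. -/
noncomputable def rightDescents (k : ℕ) (x : Equiv.Perm ℤ) : Set (ZMod (k + 1)) :=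
  {i | affLen k (x * sAff k i) < affLen k x}

/-- The cyclic interval `[i,j] = {i, i+1, …, j}` of residues mod `k+1`. -/
def cycInt (k : ℕ) (i j : ZMod (k + 1)) : Finset (ZMod (k + 1)) :=
  (Finset.range ((j - i).val + 1)).image fun t : ℕ => i + (t : ZMod (k + 1))

/-- A choice of a "gate" residue not belonging to `A` (when `A` is proper). -/
noncomputable def gate (k : ℕ) (A : Finset (ZMod (k + 1))) : ZMod (k + 1) :=
  if h : ∃ g, g ∉ A then h.choose else 0

/-- The cyclically decreasing element `d_A`: the product of the `s_a`, `a ∈ A`, in an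
order where `s_{a+1}` occurs to the left of `s_a` whenever `a, a+1 ∈ A`. -/
noncomputable def dElt (k : ℕ) (A : Finset (ZMod (k + 1))) : Equiv.Perm ℤ :=
  (((((List.range (k + 1)).reverse.map fun t : ℕ => gate k A + (t : ZMod (k + 1))).filter
      fun a => decide (a ∈ A)).map (sAff k)).prod)

/-- The cyclically increasing element `u_A`: the product of the `s_a`, `a ∈ A`, in an
order where `s_{a+1}` occurs to the right of `s_a` whenever `a, a+1 ∈ A`. -/
noncomputable def uElt (k : ℕ) (A : Finset (ZMod (k + 1))) : Equiv.Perm ℤ :=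
  ((((List.range (k + 1)).map fun t : ℕ => gate k A + (t : ZMod (k + 1))).filter
      fun a => decide (a ∈ A)).map (sAff k)).prod

/-- The right decreasing code: `CRD(x)_i = #{j < ī : x(j) > x(ī)}`. -/
noncomputable def CRD (k : ℕ) (x : Equiv.Perm ℤ) (i : ZMod (k + 1)) : ℕ :=
  Set.ncard {j : ℤ | j < (i.val : ℤ) ∧ x (i.val : ℤ) < x j}

/-- The right increasing code: `CRI(x)_i = #{j > ī + 1 : x(j) < x(ī + 1)}`. -/
noncomputable def CRI (k : ℕ) (x : Equiv.Perm ℤ) (i : ZMod (k + 1)) : ℕ :=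
  Set.ncard {j : ℤ | (i.val : ℤ) + 1 < j ∧ x j < x ((i.val : ℤ) + 1)}

/-- The left decreasing code: `CLD(x)_i = #{j < x⁻¹(ī + 1) : x(j) > ī + 1}`. -/
noncomputable def CLD (k : ℕ) (x : Equiv.Perm ℤ) (i : ZMod (k + 1)) : ℕ :=
  Set.ncard {j : ℤ | j < x.symm ((i.val : ℤ) + 1) ∧ (i.val : ℤ) + 1 < x j}

/-- The left increasing code: `CLI(x)_i = #{j > x⁻¹(ī) : x(j) < ī}`. -/
noncomputable def CLI (k : ℕ) (x : Equiv.Perm ℤ) (i : ZMod (k + 1)) : ℕ :=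
  Set.ncard {j : ℤ | x.symm ((i.val : ℤ)) < j ∧ x j < (i.val : ℤ)}

/-- A permutation of `ℤ` commuting with translation by `k + 1`. -/
def TransInv (k : ℕ) (x : Equiv.Perm ℤ) : Prop :=
  ∀ a : ℤ, x (a + (k + 1)) = x a + (k + 1)

/-- The product `s_a s_{a+1} ⋯ s_{a+m-1}`. -/
noncomputable def ascProd (k : ℕ) (a : ℤ) : ℕ → Equiv.Perm ℤ
  | 0 => 1
  | m + 1 => ascProd k a m * sAff k ((a + m : ℤ) : ZMod (k + 1))

/-- The displacement `x(r) - r` of a residue `r`. -/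
def displ (k : ℕ) (x : Equiv.Perm ℤ) (r : ZMod (k + 1)) : ℤ :=
  x (r.val : ℤ) - r.val

section Residues

variable {k : ℕ}

theorem intCast_eq_iff_exists (a b : ℤ) :
    (a : ZMod (k + 1)) = b ↔ ∃ q : ℤ, a = b + q * (k + 1) := by
  rw [ZMod.intCast_eq_intCast_iff_dvd_sub]
  constructor
  · rintro ⟨q, hq⟩
    refine ⟨-q, ?_⟩
    push_cast at hq
    linear_combination -hq
  · rintro ⟨q, hq⟩
    refine ⟨-q, ?_⟩
    push_cast
    linear_combination -hq

theorem one_ne_zero_zmod (hk : 1 ≤ k) : ¬ (1 : ZMod (k + 1)) = 0 := by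
  have : Fact (1 < k + 1) := ⟨by omega⟩
  exact one_ne_zero

theorem natCast_eq_natCast_of_lt {s t : ℕ} (hs : s < k + 1) (ht : t < k + 1)
    (h : (s : ZMod (k + 1)) = t) : s = t := by
  have := congrArg ZMod.val h
  rwa [ZMod.val_cast_of_lt hs, ZMod.val_cast_of_lt ht] at this

end Residues

section Generators

variable {k : ℕ}

theorem sAff_eq_sAffFun (hk : 1 ≤ k) (i : ZMod (k + 1)) (a : ℤ) :
    sAff k i a = sAffFun k i a := by
  unfold sAff
  rw [dif_neg (one_ne_zero_zmod hk)]
  rfl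

theorem sAff_of_eq (hk : 1 ≤ k) {i : ZMod (k + 1)} {a : ℤ} (h : (a : ZMod (k + 1)) = i) :
    sAff k i a = a + 1 := by
  rw [sAff_eq_sAffFun hk]
  exact if_pos h

theorem sAff_of_eq_succ (hk : 1 ≤ k) {i : ZMod (k + 1)} {a : ℤ}
    (h : (a : ZMod (k + 1)) = i + 1) : sAff k i a = a - 1 := by
  rw [sAff_eq_sAffFun hk]
  have hne : (a : ZMod (k + 1)) ≠ i := fun hc =>
    one_ne_zero_zmod hk (by rw [hc] at h; simpa using h.symm)
  unfold sAffFun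
  rw [if_neg hne, if_pos h]

theorem sAff_of_ne (hk : 1 ≤ k) {i : ZMod (k + 1)} {a : ℤ} (h : (a : ZMod (k + 1)) ≠ i)
    (h' : (a : ZMod (k + 1)) ≠ i + 1) : sAff k i a = a := by
  rw [sAff_eq_sAffFun hk]
  unfold sAffFun
  rw [if_neg h, if_neg h']

theorem sAff_mul_self (hk : 1 ≤ k) (i : ZMod (k + 1)) : sAff k i * sAff k i = 1 := by
  ext a
  rw [Equiv.Perm.mul_apply, sAff_eq_sAffFun hk, sAff_eq_sAffFun hk]
  exact sAffFun_invol k i (one_ne_zero_zmod hk) a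

theorem sAff_inv (hk : 1 ≤ k) (i : ZMod (k + 1)) : (sAff k i)⁻¹ = sAff k i :=
  inv_eq_of_mul_eq_one_left (sAff_mul_self hk i)

theorem transInv_sAff (hk : 1 ≤ k) (i : ZMod (k + 1)) : TransInv k (sAff k i) := by
  intro a
  have h : ((a + (k + 1) : ℤ) : ZMod (k + 1)) = a :=
    (intCast_eq_iff_exists _ _).2 ⟨1, by ring⟩
  rw [sAff_eq_sAffFun hk, sAff_eq_sAffFun hk]
  unfold sAffFun
  rw [h]
  split_ifs <;> ring

/-- A simple generator reverses the order only of adjacent integers that it interchanges. -/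
theorem eq_of_sAff_lt (hk : 1 ≤ k) {i : ZMod (k + 1)} {u v : ℤ} (huv : u < v)
    (h : sAff k i v < sAff k i u) : (u : ZMod (k + 1)) = i ∧ v = u + 1 := by
  rw [sAff_eq_sAffFun hk, sAff_eq_sAffFun hk] at h
  unfold sAffFun at h
  split_ifs at h <;> first | omega | exact ⟨by assumption, by omega⟩

end Generators

namespace TransInv

variable {k : ℕ} {x y : Equiv.Perm ℤ}

theorem one : TransInv k 1 := fun _ => rfl

theorem mul (hx : TransInv k x) (hy : TransInv k y) : TransInv k (x * y) := fun a => by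
  rw [Equiv.Perm.mul_apply, Equiv.Perm.mul_apply, hy, hx]

theorem prod (hk : 1 ≤ k) (w : List (ZMod (k + 1))) : TransInv k (w.map (sAff k)).prod := by
  induction w with
  | nil => exact one
  | cons v w ih =>
    rw [List.map_cons, List.prod_cons]
    exact (transInv_sAff hk v).mul ih

theorem apply_add_mul (hx : TransInv k x) (a q : ℤ) :
    x (a + q * (k + 1)) = x a + q * (k + 1) := by
  induction q with
  | zero => simp
  | succ q ih =>
    have := hx (a + q * (k + 1))
    rw [ih] at this
    rw [show a + ((q : ℤ) + 1) * (k + 1) = a + q * (k + 1) + (k + 1) by ring, this]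
    ring
  | pred q ih =>
    have := hx (a + (-(q : ℤ) - 1) * (k + 1))
    rw [show a + (-(q : ℤ) - 1) * (k + 1) + (k + 1) = a + -(q : ℤ) * (k + 1) by ring, ih] at this
    linear_combination -this

theorem apply_of_intCast_eq (hx : TransInv k x) {a b : ℤ} (h : (b : ZMod (k + 1)) = a) :
    x b = x a + (b - a) := by
  obtain ⟨q, rfl⟩ := (intCast_eq_iff_exists _ _).1 h
  rw [hx.apply_add_mul]
  ring

theorem intCast_eq_of_apply (hx : TransInv k x) {a b : ℤ}
    (h : (x b : ZMod (k + 1)) = x a) : (b : ZMod (k + 1)) = a := by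
  obtain ⟨q, hq⟩ := (intCast_eq_iff_exists _ _).1 h
  rw [← hx.apply_add_mul] at hq
  exact (intCast_eq_iff_exists _ _).2 ⟨q, x.injective hq⟩

/-- If `z` carries `a, a+1` to `c, c+1`, then it conjugates `s_a` to `s_c`. -/
theorem sAff_mul (hk : 1 ≤ k) {z : Equiv.Perm ℤ} (hz : TransInv k z) {a : ℤ}
    (h : z (a + 1) = z a + 1) :
    sAff k (z a : ℤ) * z = z * sAff k (a : ℤ) := by
  ext b
  rw [Equiv.Perm.mul_apply, Equiv.Perm.mul_apply]
  by_cases h1 : (b : ZMod (k + 1)) = a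
  · have e1 := hz.apply_of_intCast_eq h1
    have e2 : z (b + 1) = z (a + 1) + (b + 1 - (a + 1)) :=
      hz.apply_of_intCast_eq (by push_cast; rw [h1])
    obtain ⟨q, hq⟩ := (intCast_eq_iff_exists _ _).1 h1
    rw [sAff_of_eq hk h1,
      sAff_of_eq hk ((intCast_eq_iff_exists _ _).2 ⟨q, by rw [e1, hq]; ring⟩)]
    omega
  · by_cases h2 : (b : ZMod (k + 1)) = a + 1
    · have h2' : (b : ZMod (k + 1)) = ((a + 1 : ℤ) : ZMod (k + 1)) := by push_cast; exact h2
      have e1 := hz.apply_of_intCast_eq h2'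
      have e2 : z (b - 1) = z a + (b - 1 - a) :=
        hz.apply_of_intCast_eq (by push_cast; rw [h2]; ring)
      obtain ⟨q, hq⟩ := (intCast_eq_iff_exists _ _).1 h2'
      have e3 : (z b : ZMod (k + 1)) = ((z a + 1 : ℤ) : ZMod (k + 1)) :=
        (intCast_eq_iff_exists _ _).2 ⟨q, by rw [e1, hq, h]; ring⟩
      rw [sAff_of_eq_succ hk h2, sAff_of_eq_succ hk (by rw [e3]; push_cast; rfl)]
      omega
    · rw [sAff_of_ne hk h1 h2, sAff_of_ne hk]
      · exact fun hc => h1 (hz.intCast_eq_of_apply hc)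
      · intro hc
        apply h2
        have := hz.intCast_eq_of_apply (a := a + 1) (b := b) (by rw [hc, h]; push_cast; rfl)
        rw [this]; push_cast; rfl

theorem displ_intCast (hx : TransInv k x) (a : ℤ) : displ k x (a : ZMod (k + 1)) = x a - a := by
  have h : ((((a : ZMod (k + 1)).val : ℕ) : ℤ) : ZMod (k + 1)) = a := by simp
  have := hx.apply_of_intCast_eq h
  unfold displ
  omega

end TransInv

section Generation

variable {k : ℕ} {x : Equiv.Perm ℤ}

theorem exists_descent_or_displ_const (hx : TransInv k x) :
    (∃ a : ℤ, x (a + 1) < x a) ∨ ∃ c : ℤ, ∀ a : ℤ, x a = a + c := by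
  by_cases h : ∃ a : ℤ, x (a + 1) < x a
  · exact Or.inl h
  right
  push Not at h
  have hmono : Monotone fun a : ℤ => x a - a := by
    refine monotone_int_of_le_succ fun a => ?_
    have h1 := h a
    have h2 : x a ≠ x (a + 1) := fun hc => by
      have := x.injective hc
      omega
    show x a - a ≤ x (a + 1) - (a + 1)
    omega
  refine ⟨x 0, fun a => ?_⟩
  have hper : ∀ q : ℤ, x (q * (k + 1)) = x 0 + q * (k + 1) := fun q => by
    simpa using hx.apply_add_mul 0 q
  have hab : |a| ≤ |a| * (k + 1) := by nlinarith [abs_nonneg a, Int.natCast_nonneg k]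
  have h1 : x a - a ≤ x (|a| * (k + 1)) - |a| * (k + 1) :=
    hmono (le_trans (le_abs_self a) hab)
  have h2 : x (-|a| * (k + 1)) - -|a| * (k + 1) ≤ x a - a :=
    hmono (by have := neg_abs_le a; linarith)
  rw [hper] at h1 h2
  omega

theorem sum_eq_add_add_sum (hk : 1 ≤ k) (i : ZMod (k + 1)) (f : ZMod (k + 1) → ℤ) :
    ∑ r, f r = f i + f (i + 1) + ∑ r ∈ (Finset.univ.erase i).erase (i + 1), f r := by
  have hne : i + 1 ≠ i := fun hc => one_ne_zero_zmod hk (by simpa using hc)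
  rw [← Finset.add_sum_erase _ _ (Finset.mem_univ i),
    ← Finset.add_sum_erase (Finset.univ.erase i) _
      (Finset.mem_erase.2 ⟨hne, Finset.mem_univ (i + 1)⟩)]
  ring

theorem displ_mul_sAff_self (hk : 1 ≤ k) (hx : TransInv k x) (a : ℤ) :
    displ k (x * sAff k (a : ZMod (k + 1))) (a : ZMod (k + 1)) = x (a + 1) - a := by
  rw [(hx.mul (transInv_sAff hk _)).displ_intCast, Equiv.Perm.mul_apply, sAff_of_eq hk rfl]

theorem displ_mul_sAff_succ (hk : 1 ≤ k) (hx : TransInv k x) (a : ℤ) :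
    displ k (x * sAff k (a : ZMod (k + 1))) ((a : ZMod (k + 1)) + 1) = x a - (a + 1) := by
  have := (hx.mul (transInv_sAff hk (a : ZMod (k + 1)))).displ_intCast (a + 1)
  rw [Equiv.Perm.mul_apply, sAff_of_eq_succ hk (by push_cast; rfl)] at this
  push_cast at this
  rw [this]
  congr 2
  ring

theorem displ_mul_sAff_of_ne (hk : 1 ≤ k) {i r : ZMod (k + 1)} (h : r ≠ i) (h' : r ≠ i + 1) :
    displ k (x * sAff k i) r = displ k x r := by
  unfold displ
  rw [Equiv.Perm.mul_apply, sAff_of_ne hk (by simpa using h) (by simpa using h')]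

theorem sum_displ_mul_sAff (hk : 1 ≤ k) (hx : TransInv k x) (a : ℤ) (g : ℤ → ℤ) :
    ∑ r, g (displ k (x * sAff k (a : ZMod (k + 1))) r) - ∑ r, g (displ k x r) =
      g (x (a + 1) - a) + g (x a - (a + 1)) - g (x a - a) - g (x (a + 1) - (a + 1)) := by
  rw [sum_eq_add_add_sum hk (a : ZMod (k + 1)),
    sum_eq_add_add_sum hk (a : ZMod (k + 1)) fun r => g (displ k x r),
    displ_mul_sAff_self hk hx, displ_mul_sAff_succ hk hx, hx.displ_intCast]
  have h1 := hx.displ_intCast (a + 1)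
  push_cast at h1
  rw [h1, Finset.sum_congr rfl fun r hr => ?_]
  · ring
  · simp only [Finset.mem_erase, Finset.mem_univ, and_true] at hr
    rw [displ_mul_sAff_of_ne hk hr.2 hr.1]

/-- Permutations commuting with translation whose displacements sum to zero are products of simple
generators. -/
theorem exists_word (hk : 1 ≤ k) (hx : TransInv k x) (h0 : ∑ r, displ k x r = 0) :
    ∃ w : List (ZMod (k + 1)), x = (w.map (sAff k)).prod := by
  induction hN : (∑ r, displ k x r ^ 2).toNat using Nat.strong_induction_on generalizing x with
  | _ N ih =>
  rcases exists_descent_or_displ_const hx with ⟨a, ha⟩ | ⟨c, hc⟩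
  · set y := x * sAff k (a : ZMod (k + 1)) with hy
    have hsum := sum_displ_mul_sAff hk hx a fun d => d
    have hsq := sum_displ_mul_sAff hk hx a fun d => d ^ 2
    rw [← hy] at hsum hsq
    have hy0 : ∑ r, displ k y r = 0 := by linarith
    have hpos : 0 ≤ ∑ r, displ k y r ^ 2 := Finset.sum_nonneg fun r _ => sq_nonneg _
    have hlt : ∑ r, displ k y r ^ 2 < ∑ r, displ k x r ^ 2 := by nlinarith
    have hdec : (∑ r, displ k y r ^ 2).toNat < N := by omega
    obtain ⟨w, hw⟩ := ih _ hdec (hx.mul (transInv_sAff hk _)) hy0 rfl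
    refine ⟨w ++ [(a : ZMod (k + 1))], ?_⟩
    rw [List.map_append, List.prod_append, ← hw]
    simp [mul_assoc, sAff_mul_self hk]
  · have hd : ∀ r, displ k x r = c := fun r => by unfold displ; rw [hc]; ring
    simp only [hd, Finset.sum_const, Finset.card_univ, ZMod.card, nsmul_eq_mul] at h0
    have hc0 : c = 0 := by
      rcases mul_eq_zero.1 h0 with h | h
      · exact absurd h (by positivity)
      · exact h
    refine ⟨[], ?_⟩
    ext b
    simp [hc, hc0]

theorem sum_displ_eq_zero (hx : IsAffinePerm k x) : ∑ r, displ k x r = 0 := by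
  have ht : TransInv k x := hx.1
  have h1 : ∑ r, displ k x r = ∑ a ∈ Finset.Icc (1 : ℤ) (k + 1), (x a - a) := by
    symm
    refine Finset.sum_bij (fun a _ => (a : ZMod (k + 1))) (fun _ _ => Finset.mem_univ _) ?_ ?_ ?_
    · intro a ha b hb hab
      obtain ⟨q, hq⟩ := (intCast_eq_iff_exists _ _).1 hab
      rw [Finset.mem_Icc] at ha hb
      have : q = 0 := by
        by_contra hne
        rcases lt_or_gt_of_ne hne with h | h <;> nlinarith
      simp [hq, this]
    · intro r _
      by_cases hr : r = 0
      · refine ⟨k + 1, Finset.mem_Icc.2 (by omega), ?_⟩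
        have := ZMod.natCast_self (k + 1)
        push_cast at this ⊢
        rw [this, hr]
      · refine ⟨r.val, Finset.mem_Icc.2 ?_, by simp⟩
        have h2 := ZMod.val_lt r
        have h3 : r.val ≠ 0 := fun h => hr ((ZMod.val_eq_zero r).1 h)
        omega
    · intro a _
      exact (ht.displ_intCast a).symm
  have h2 : ∀ n : ℕ, 2 * ∑ a ∈ Finset.Icc (1 : ℤ) n, a = n * (n + 1) := by
    intro n
    induction n with
    | zero => simp
    | succ n ih =>
      have : Finset.Icc (1 : ℤ) ((n + 1 : ℕ) : ℤ) =
          insert ((n : ℤ) + 1) (Finset.Icc (1 : ℤ) n) := by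
        ext b
        simp only [Finset.mem_Icc, Finset.mem_insert]
        omega
      rw [this, Finset.sum_insert (by simp), mul_add, ih]
      push_cast
      ring
  have h3 := h2 (k + 1)
  push_cast at h3
  rw [h1, Finset.sum_sub_distrib, hx.2]
  rw [show ((k : ℤ) + 1) * (k + 2) = 2 * ∑ a ∈ Finset.Icc (1 : ℤ) (k + 1), a by rw [h3]; ring]
  rw [Int.mul_ediv_cancel_left _ (by norm_num)]
  ring

end Generation

section Length

variable {k : ℕ} {x : Equiv.Perm ℤ}

theorem exists_reduced_word (h : ∃ w : List (ZMod (k + 1)), x = (w.map (sAff k)).prod) :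
    ∃ w : List (ZMod (k + 1)), w.length = affLen k x ∧ x = (w.map (sAff k)).prod := by
  obtain ⟨w, hw⟩ := h
  exact Nat.sInf_mem
    (s := {n : ℕ | ∃ w : List (ZMod (k + 1)), w.length = n ∧ x = (w.map (sAff k)).prod})
    ⟨w.length, w, rfl, hw⟩

theorem affLen_le_length {w : List (ZMod (k + 1))} (h : x = (w.map (sAff k)).prod) :
    affLen k x ≤ w.length :=
  Nat.sInf_le ⟨w, rfl, h⟩

theorem exists_word_mul_sAff (h : ∃ w : List (ZMod (k + 1)), x = (w.map (sAff k)).prod)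
    (i : ZMod (k + 1)) : ∃ w : List (ZMod (k + 1)), x * sAff k i = (w.map (sAff k)).prod := by
  obtain ⟨w, rfl⟩ := h
  exact ⟨w ++ [i], by simp⟩

theorem affLen_mul_sAff_le (h : ∃ w : List (ZMod (k + 1)), x = (w.map (sAff k)).prod)
    (i : ZMod (k + 1)) : affLen k (x * sAff k i) ≤ affLen k x + 1 := by
  obtain ⟨w, hl, hw⟩ := exists_reduced_word h
  have : x * sAff k i = ((w ++ [i]).map (sAff k)).prod := by rw [hw]; simp
  simpa [hl] using affLen_le_length this

/-- The exchange property. -/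
theorem exists_shorter_word (hk : 1 ≤ k) (w : List (ZMod (k + 1))) (a : ℤ)
    (h : (w.map (sAff k)).prod (a + 1) < (w.map (sAff k)).prod a) :
    ∃ w' : List (ZMod (k + 1)), w'.length + 1 = w.length ∧
      (w.map (sAff k)).prod * sAff k (a : ZMod (k + 1)) = (w'.map (sAff k)).prod := by
  induction w with
  | nil => simp at h
  | cons v w ih =>
    have hz := TransInv.prod hk w
    rw [List.map_cons, List.prod_cons] at h ⊢
    set z := (w.map (sAff k)).prod with hzdef
    rcases lt_trichotomy (z (a + 1)) (z a) with hlt | heq | hgt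
    · obtain ⟨w', hl, hw'⟩ := ih hlt
      exact ⟨v :: w', by simp [hl], by rw [mul_assoc, hw']; simp⟩
    · have := z.injective heq
      omega
    · rw [Equiv.Perm.mul_apply, Equiv.Perm.mul_apply] at h
      obtain ⟨hv, hsucc⟩ := eq_of_sAff_lt hk hgt h
      refine ⟨w, rfl, ?_⟩
      rw [← hv, hz.sAff_mul hk hsucc, mul_assoc, sAff_mul_self hk, mul_one]

theorem affLen_mul_sAff_of_descent (hk : 1 ≤ k)
    (h : ∃ w : List (ZMod (k + 1)), x = (w.map (sAff k)).prod) {a : ℤ} (ha : x (a + 1) < x a) :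
    affLen k (x * sAff k (a : ZMod (k + 1))) + 1 = affLen k x := by
  obtain ⟨w, hl, hw⟩ := exists_reduced_word h
  obtain ⟨w', hl', hw'⟩ := exists_shorter_word hk w a (by rwa [← hw])
  rw [← hw] at hw'
  have h1 := affLen_le_length hw'
  have h2 := affLen_mul_sAff_le (exists_word_mul_sAff h (a : ZMod (k + 1))) (a : ZMod (k + 1))
  rw [mul_assoc, sAff_mul_self hk, mul_one] at h2
  omega

theorem affLen_mul_sAff_of_ascent (hk : 1 ≤ k)
    (h : ∃ w : List (ZMod (k + 1)), x = (w.map (sAff k)).prod) {a : ℤ} (ha : x a < x (a + 1)) :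
    affLen k (x * sAff k (a : ZMod (k + 1))) = affLen k x + 1 := by
  have := affLen_mul_sAff_of_descent hk (exists_word_mul_sAff h (a : ZMod (k + 1))) (a := a) (by
    rw [Equiv.Perm.mul_apply, Equiv.Perm.mul_apply, sAff_of_eq hk rfl,
      sAff_of_eq_succ hk (by push_cast; rfl)]
    simpa using ha)
  rw [mul_assoc, sAff_mul_self hk, mul_one] at this
  exact this.symm

theorem exists_word_mul_ascProd (h : ∃ w : List (ZMod (k + 1)), x = (w.map (sAff k)).prod)
    (a : ℤ) (m : ℕ) : ∃ w : List (ZMod (k + 1)), x * ascProd k a m = (w.map (sAff k)).prod := by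
  induction m with
  | zero => simpa [ascProd] using h
  | succ m ih =>
    rw [ascProd, ← mul_assoc]
    exact exists_word_mul_sAff ih _

theorem ascProd_apply_end (hk : 1 ≤ k) (a : ℤ) (m : ℕ) : ascProd k a m (a + m) = a := by
  induction m with
  | zero => simp [ascProd]
  | succ m ih =>
    rw [ascProd, Equiv.Perm.mul_apply, sAff_of_eq_succ hk (by push_cast; ring)]
    rw [show a + ((m + 1 : ℕ) : ℤ) - 1 = a + m by push_cast; ring, ih]

theorem ascProd_apply_of_lt (hk : 1 ≤ k) (a : ℤ) {m t : ℕ} (hmt : m < t) (ht : t ≤ k) :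
    ascProd k a m (a + t) = a + t := by
  have hne : ∀ s : ℕ, s < t → ((a + t : ℤ) : ZMod (k + 1)) ≠ ((a + s : ℤ) : ZMod (k + 1)) := by
    intro s hs hc
    push_cast at hc
    have := natCast_eq_natCast_of_lt (by omega) (by omega) (add_left_cancel hc)
    omega
  induction m with
  | zero => simp [ascProd]
  | succ m ih =>
    have h1 := hne (m + 1) hmt
    push_cast at h1
    rw [ascProd, Equiv.Perm.mul_apply, sAff_of_ne hk (hne m (by omega)), ih (by omega)]
    push_cast
    rwa [add_assoc]

theorem affLen_le_affLen_mul_ascProd (hk : 1 ≤ k)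
    (h : ∃ w : List (ZMod (k + 1)), x = (w.map (sAff k)).prod) (a : ℤ) (m : ℕ) :
    affLen k x ≤ affLen k (x * ascProd k a m) + m := by
  induction m with
  | zero => simp [ascProd]
  | succ m ih =>
    have h2 := affLen_mul_sAff_le
      (exists_word_mul_sAff (exists_word_mul_ascProd h a m) ((a + m : ℤ) : ZMod (k + 1)))
      ((a + m : ℤ) : ZMod (k + 1))
    rw [mul_assoc, sAff_mul_self hk, mul_one, mul_assoc] at h2
    change _ ≤ affLen k (x * ascProd k a (m + 1)) + 1 at h2
    omega

/-- Peeling `s_a ⋯ s_{a+m-1}` off `x` lowers the length by `m` exactly when `x(a)` exceeds each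
of `x(a+1), …, x(a+m)`. -/
theorem affLen_mul_ascProd_iff (hk : 1 ≤ k)
    (h : ∃ w : List (ZMod (k + 1)), x = (w.map (sAff k)).prod) (a : ℤ) {m : ℕ} (hm : m ≤ k) :
    affLen k (x * ascProd k a m) + m = affLen k x ↔
      ∀ t : ℕ, 1 ≤ t → t ≤ m → x (a + t) < x a := by
  induction m with
  | zero =>
    simp only [ascProd, mul_one, add_zero, true_iff]
    intro t h1 h2
    omega
  | succ m ih =>
    have ih := ih (by omega)
    have hw := exists_word_mul_ascProd h a m
    have hle := affLen_le_affLen_mul_ascProd hk h a m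
    have e1 : (x * ascProd k a m) (a + m) = x a := by
      rw [Equiv.Perm.mul_apply, ascProd_apply_end hk]
    have e2 : (x * ascProd k a m) (a + m + 1) = x (a + (m + 1 : ℕ)) := by
      have := ascProd_apply_of_lt hk a (Nat.lt_succ_self m) hm
      rw [Equiv.Perm.mul_apply, add_assoc, ← Nat.cast_succ, this]
    rw [ascProd, ← mul_assoc]
    rcases lt_or_ge (x (a + (m + 1 : ℕ))) (x a) with hlt | hge
    · have h3 := affLen_mul_sAff_of_descent hk hw (a := a + m) (by rwa [e1, e2])
      rw [show ∀ p q r : ℕ, p + (q + 1) = r ↔ (p + 1) + q = r by intros; omega, h3, ih]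
      constructor
      · intro H t h1 h2
        rcases Nat.lt_or_ge t (m + 1) with h4 | h4
        · exact H t h1 (by omega)
        · obtain rfl : t = m + 1 := by omega
          exact hlt
      · exact fun H t h1 h2 => H t h1 (by omega)
    · have hne : x a ≠ x (a + (m + 1 : ℕ)) := fun hc => by
        have := x.injective hc
        push_cast at this
        omega
      have h3 := affLen_mul_sAff_of_ascent hk hw (a := a + m) (by
        rw [e1, e2]
        exact lt_of_le_of_ne hge hne)
      constructor
      · intro H
        omega
      · intro H
        exact absurd (H (m + 1) (by omega) le_rfl) (not_lt.2 hge)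

end Length

section Intervals

variable {k : ℕ}

theorem mem_cycInt {i j r : ZMod (k + 1)} :
    r ∈ cycInt k i j ↔ ∃ u : ℕ, u ≤ (j - i).val ∧ r = i + u := by
  simp only [cycInt, Finset.mem_image, Finset.mem_range, Nat.lt_succ_iff]
  exact exists_congr fun u => and_congr_right fun _ => eq_comm

theorem card_cycInt (i j : ZMod (k + 1)) : (cycInt k i j).card = (j - i).val + 1 := by
  unfold cycInt
  rw [Finset.card_image_of_injOn, Finset.card_range]
  intro s hs t ht hst
  have hlt := ZMod.val_lt (j - i)
  simp only [Finset.coe_range, Set.mem_Iio] at hs ht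
  exact natCast_eq_natCast_of_lt (by omega) (by omega) (add_left_cancel hst)

theorem val_sub_lt_of_ne_univ {i j : ZMod (k + 1)} (h : cycInt k i j ≠ Finset.univ) :
    (j - i).val + 1 ≤ k := by
  have := (Finset.card_lt_iff_ne_univ _).2 h
  rw [card_cycInt, ZMod.card] at this
  omega

theorem gate_notMem {A : Finset (ZMod (k + 1))} (h : A ≠ Finset.univ) : gate k A ∉ A := by
  have hex : ∃ g, g ∉ A := by
    by_contra hc
    push Not at hc
    exact h (Finset.eq_univ_iff_forall.2 hc)
  unfold gate
  rw [dif_pos hex]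
  exact hex.choose_spec

theorem prod_map_sAff_inv (hk : 1 ≤ k) (w : List (ZMod (k + 1))) :
    ((w.map (sAff k)).prod)⁻¹ = (w.reverse.map (sAff k)).prod := by
  induction w with
  | nil => simp
  | cons v w ih => simp [ih, sAff_inv hk]

theorem filter_range_eq_range' {n s m : ℕ} (p : ℕ → Bool) (hsm : s + m ≤ n)
    (hp : ∀ t < n, p t = true ↔ s ≤ t ∧ t < s + m) :
    (List.range n).filter p = List.range' s m := by
  obtain ⟨r, rfl⟩ := Nat.exists_eq_add_of_le hsm
  rw [List.range_eq_range', ← List.range'_append_1, ← List.range'_append_1, List.filter_append,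
    List.filter_append, List.filter_eq_nil_iff.2, List.filter_eq_self.2, List.filter_eq_nil_iff.2]
  · simp
  all_goals
    intro t ht
    rw [List.mem_range'_1] at ht
    rw [hp t (by omega)]
    omega

theorem prod_range'_eq_ascProd (g : ZMod (k + 1)) (s m : ℕ) (a : ℤ)
    (h : (a : ZMod (k + 1)) = g + s) :
    (((List.range' s m).map fun t : ℕ => g + (t : ZMod (k + 1))).map (sAff k)).prod =
      ascProd k a m := by
  induction m with
  | zero => simp [ascProd]
  | succ m ih =>
    rw [List.range'_1_concat, List.map_append, List.map_append, List.prod_append, ih, ascProd]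
    simp [h, add_assoc]

theorem dElt_cycInt_inv (hk : 1 ≤ k) {i j : ZMod (k + 1)} (hne : cycInt k i j ≠ Finset.univ)
    {a : ℤ} (ha : (a : ZMod (k + 1)) = i) :
    (dElt k (cycInt k i j))⁻¹ = ascProd k a ((j - i).val + 1) := by
  have hg := gate_notMem hne
  unfold dElt
  rw [prod_map_sAff_inv hk]
  set g := gate k (cycInt k i j)
  set s := (i - g).val with hs
  have hi : i = g + (s : ZMod (k + 1)) := by simp [hs]
  have hslt : s < k + 1 := ZMod.val_lt _
  have hmlt := ZMod.val_lt (j - i)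
  have hsm : s + ((j - i).val + 1) ≤ k + 1 := by
    by_contra hc
    refine hg (mem_cycInt.2 ⟨k + 1 - s, by omega, ?_⟩)
    rw [hi, add_assoc, ← Nat.cast_add, Nat.add_sub_cancel' hslt.le, ZMod.natCast_self, add_zero]
  rw [← List.filter_reverse, ← List.map_reverse, List.reverse_reverse, List.filter_map,
    filter_range_eq_range' _ hsm, prod_range'_eq_ascProd g s _ a (ha.trans hi)]
  intro t ht
  simp only [Function.comp_apply, decide_eq_true_eq, mem_cycInt]
  constructor
  · rintro ⟨u, hu, he⟩
    rw [hi, add_assoc, ← Nat.cast_add] at he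
    have := natCast_eq_natCast_of_lt ht (by omega) (add_left_cancel he)
    omega
  · rintro ⟨h1, h2⟩
    refine ⟨t - s, by omega, ?_⟩
    rw [hi, add_assoc, ← Nat.cast_add, Nat.add_sub_cancel' h1]

theorem sub_one_mem_cycInt {p q r : ZMod (k + 1)} (h : r ∈ cycInt k p q) (hne : r ≠ p) :
    r - 1 ∈ cycInt k p q := by
  obtain ⟨u, hu, rfl⟩ := mem_cycInt.1 h
  obtain ⟨v, rfl⟩ : ∃ v, u = v + 1 := Nat.exists_eq_succ_of_ne_zero (by rintro rfl; simp at hne)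
  exact mem_cycInt.2 ⟨v, by omega, by push_cast; ring⟩

theorem left_mem_cycInt (i j : ZMod (k + 1)) : i ∈ cycInt k i j :=
  mem_cycInt.2 ⟨0, Nat.zero_le _, by simp⟩

theorem left_sub_one_notMem_cycInt {i j : ZMod (k + 1)} (h : cycInt k i j ≠ Finset.univ) :
    i - 1 ∉ cycInt k i j := by
  intro hc
  obtain ⟨u, hu, he⟩ := mem_cycInt.1 hc
  have hm := val_sub_lt_of_ne_univ h
  have : ((u + 1 : ℕ) : ZMod (k + 1)) = (0 : ℕ) := by
    push_cast
    linear_combination -he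
  have := natCast_eq_natCast_of_lt (by omega) (by omega) this
  omega

end Intervals

/-- `x(a)` exceeds `x(a+1), …, x(a+m)` but not `x(a+m+1)`. -/
def IsRun (x : Equiv.Perm ℤ) (a : ℤ) (m : ℕ) : Prop :=
  (∀ t : ℕ, 1 ≤ t → t ≤ m → x (a + t) < x a) ∧ x a < x (a + (m + 1 : ℕ))

section Nesting

variable {k : ℕ} {x : Equiv.Perm ℤ}

theorem isRun_of_maximal (hk : 1 ≤ k) (hx : IsAffinePerm k x) {i j : ZMod (k + 1)}
    (hne : cycInt k i j ≠ Finset.univ)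
    (hred : affLen k (x * (dElt k (cycInt k i j))⁻¹) + (cycInt k i j).card = affLen k x)
    (hmax : ∀ j' : ZMod (k + 1), cycInt k i j' ≠ Finset.univ →
      affLen k (x * (dElt k (cycInt k i j'))⁻¹) + (cycInt k i j').card = affLen k x →
      cycInt k i j' ⊆ cycInt k i j) {a : ℤ} (ha : (a : ZMod (k + 1)) = i) :
    IsRun x a ((j - i).val + 1) := by
  have hw := exists_word hk hx.1 (sum_displ_eq_zero hx)
  have hm := val_sub_lt_of_ne_univ hne
  rw [dElt_cycInt_inv hk hne ha, card_cycInt, affLen_mul_ascProd_iff hk hw a hm] at hred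
  refine ⟨hred, ?_⟩
  rcases hm.lt_or_eq with hlt | heq
  · by_contra hge
    have hval : (j + 1 - i).val = (j - i).val + 1 := by
      have : j + 1 - i = (((j - i).val + 1 : ℕ) : ZMod (k + 1)) := by
        push_cast
        rw [ZMod.natCast_zmod_val]
        ring
      rw [this, ZMod.val_cast_of_lt (by omega)]
    have hcard := card_cycInt i (j + 1)
    have hne' : cycInt k i (j + 1) ≠ Finset.univ := by
      rw [← Finset.card_lt_iff_ne_univ, hcard, ZMod.card]
      omega
    have hsub := hmax (j + 1) hne' (by
      rw [dElt_cycInt_inv hk hne' ha, hcard, hval, affLen_mul_ascProd_iff hk hw a (by omega)]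
      intro t h1 h2
      rcases Nat.lt_or_ge t ((j - i).val + 1 + 1) with h3 | h3
      · exact hred t h1 (by omega)
      · obtain rfl : t = (j - i).val + 1 + 1 := by omega
        refine lt_of_le_of_ne (not_lt.1 hge) fun hc => ?_
        have := x.injective hc
        push_cast at this
        omega)
    have := Finset.card_le_card hsub
    rw [hcard, card_cycInt] at this
    omega
  · rw [heq]
    have := hx.1 a
    push_cast
    omega

theorem cycInt_subset_of_isRun {i j p q : ZMod (k + 1)} {a b : ℤ}
    (ha : (a : ZMod (k + 1)) = i) (hb : (b : ZMod (k + 1)) = p)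
    (hA : IsRun x a ((j - i).val + 1)) (hB : IsRun x b ((q - p).val + 1))
    (hab : a ≤ b) (hba : b ≤ a + (j - i).val) : cycInt k p q ⊆ cycInt k i j := by
  obtain ⟨d, rfl⟩ := Int.le.dest hab
  have hle : x (a + d) ≤ x a := by
    rcases Nat.eq_zero_or_pos d with rfl | hd
    · simp
    · exact (hA.1 d hd (by omega)).le
  have hend : d + (q - p).val ≤ (j - i).val := by
    by_contra hc
    have h1 := hB.1 ((j - i).val + 1 + 1 - d) (by omega) (by omega)
    rw [add_assoc, ← Nat.cast_add, Nat.add_sub_cancel' (by omega)] at h1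
    have h2 := hA.2
    omega
  intro r hr
  obtain ⟨u, hu, rfl⟩ := mem_cycInt.1 hr
  refine mem_cycInt.2 ⟨d + u, by omega, ?_⟩
  rw [← hb, ← ha]
  push_cast
  ring

theorem union_ne_cycInt_of_isRun {i j p q p' q' : ZMod (k + 1)}
    (hB : cycInt k p q ≠ Finset.univ)
    (hrunA : ∀ a : ℤ, (a : ZMod (k + 1)) = i → IsRun x a ((j - i).val + 1))
    (hrunB : ∀ b : ℤ, (b : ZMod (k + 1)) = p → IsRun x b ((q - p).val + 1))
    (hdisj : Disjoint (cycInt k i j) (cycInt k p q)) (hp' : p' ∈ cycInt k i j) :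
    cycInt k i j ∪ cycInt k p q ≠ cycInt k p' q' := by
  intro hU
  have hpA : p ∉ cycInt k i j := fun h => Finset.disjoint_left.1 hdisj h (left_mem_cycInt p q)
  have hpU : p ∈ cycInt k p' q' := hU ▸ Finset.mem_union_right _ (left_mem_cycInt p q)
  have hpred := sub_one_mem_cycInt hpU fun h => hpA (h ▸ hp')
  rw [← hU, Finset.mem_union] at hpred
  have hmem := hpred.resolve_right (left_sub_one_notMem_cycInt hB)
  obtain ⟨u, hu, he⟩ := mem_cycInt.1 hmem
  have hpe : p = i + ((u + 1 : ℕ) : ZMod (k + 1)) := by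
    push_cast
    linear_combination he
  obtain rfl : u = (j - i).val := by
    by_contra hc
    exact hpA (mem_cycInt.2 ⟨u + 1, by omega, hpe⟩)
  have ha : ((i.val : ℤ) : ZMod (k + 1)) = i := by simp
  have h1 := hrunA i.val ha
  have h2 := hrunB (i.val + ((j - i).val + 1 : ℕ)) (by
    rw [hpe, Int.cast_add, ha, Int.cast_natCast])
  have h3 := h1.1 _ (Nat.le_add_left 1 _) le_rfl
  have h4 := h2.1 1 le_rfl (by omega)
  have h5 := h1.2
  rw [Nat.cast_add _ 1, ← add_assoc] at h5
  omega

end Nesting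

/-- nesting of maximal cyclic intervals that can be peeled off `x`. -/
theorem max_interval_nesting (k : ℕ) (hk : 1 ≤ k) (x : Equiv.Perm ℤ)
    (hx : IsAffinePerm k x) (i p j₁ j₂ : ZMod (k + 1))
    (A B : Finset (ZMod (k + 1)))
    (hA : A = cycInt k i j₁) (hB : B = cycInt k p j₂)
    (hAproper : A ≠ Finset.univ) (hBproper : B ≠ Finset.univ)
    (hAred : affLen k (x * (dElt k A)⁻¹) + A.card = affLen k x)
    (hBred : affLen k (x * (dElt k B)⁻¹) + B.card = affLen k x)
    (hAmax : ∀ j' : ZMod (k + 1), cycInt k i j' ≠ Finset.univ →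
      affLen k (x * (dElt k (cycInt k i j'))⁻¹) + (cycInt k i j').card = affLen k x →
      cycInt k i j' ⊆ A)
    (hBmax : ∀ j' : ZMod (k + 1), cycInt k p j' ≠ Finset.univ →
      affLen k (x * (dElt k (cycInt k p j'))⁻¹) + (cycInt k p j').card = affLen k x →
      cycInt k p j' ⊆ B) :
    ((A ∩ B).Nonempty → A ⊆ B ∨ B ⊆ A) ∧
    (A ∩ B = ∅ → ∀ p' q' : ZMod (k + 1), A ∪ B ≠ cycInt k p' q') := by
  subst hA hB
  have hrunA := fun a ha => isRun_of_maximal hk hx hAproper hAred hAmax (a := a) ha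
  have hrunB := fun b hb => isRun_of_maximal hk hx hBproper hBred hBmax (a := b) hb
  constructor
  · rintro ⟨r, hr⟩
    rw [Finset.mem_inter] at hr
    obtain ⟨u, hu, hru⟩ := mem_cycInt.1 hr.1
    obtain ⟨v, hv, hrv⟩ := mem_cycInt.1 hr.2
    have ha : ((i.val : ℤ) : ZMod (k + 1)) = i := by simp
    have hb : ((i.val + u - v : ℤ) : ZMod (k + 1)) = p := by
      rw [Int.cast_sub, Int.cast_add, ha, Int.cast_natCast, Int.cast_natCast, ← hru, hrv]
      ring
    rcases le_total (i.val : ℤ) (i.val + u - v) with h | h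
    · exact Or.inr (cycInt_subset_of_isRun ha hb (hrunA _ ha) (hrunB _ hb) h (by omega))
    · exact Or.inl (cycInt_subset_of_isRun hb ha (hrunB _ hb) (hrunA _ ha) h (by omega))
  · intro hdisj p' q' hU
    have hd : Disjoint (cycInt k i j₁) (cycInt k p j₂) := Finset.disjoint_iff_inter_eq_empty.2 hdisj
    have hp' : p' ∈ cycInt k i j₁ ∪ cycInt k p j₂ := hU ▸ left_mem_cycInt p' q'
    rcases Finset.mem_union.1 hp' with h | h
    · exact union_ne_cycInt_of_isRun hBproper hrunA hrunB hd h hU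
    · exact union_ne_cycInt_of_isRun hAproper hrunB hrunA hd.symm h
        ((Finset.union_comm _ _).trans hU)
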